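/- arXiv:1303.5131 — 6 statements merged into one kernel-verified Lean document; each statement's English description precedes it below -/
import Mathlib

section
/- Let γ be the complete multipartite graph of the form G + K_{q₁,q₂,q₃,q₄}, where G and K_{q₁,q₂,q₃,q₄} are (possibly empty) complete multipartite graphs such that every partite set of G has even size, and one of the following holds: (1) all qᵢ = 0; (2) one qᵢ is odd and all other qᵢ = 0; (3) two qᵢ = 1, one qᵢ = 0, and the last qᵢ is either odd or 0; (4) all qᵢ = 1. Then γ admits an embedding in S³ = ℝ³ ∪ {∞} that is setwise invariant under the homeomorphism h of S³ defined by h(x) = −x for x ∈ ℝ³ and h(∞) = ∞ (the orientation-reversing point inversion, of order 2). -/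
open unitInterval

/-- An embedding of a simple graph `G` in a topological space `X`: an injective map on
vertices together with, for each edge, an injective path between the endpoints, such that
the interiors of the edge paths (images of the open unit interval) are pairwise disjoint
and disjoint from the set of embedded vertices. -/
structure GraphEmbedding {V : Type*} (G : SimpleGraph V) (X : Type*) [TopologicalSpace X] where
  vmap : V → X
  vmap_inj : Function.Injective vmap
  epath : ∀ u v : V, G.Adj u v → Path (vmap u) (vmap v)
  epath_inj : ∀ (u v : V) (h : G.Adj u v), Function.Injective ⇑(epath u v h)
  epath_symm : ∀ (u v : V) (h : G.Adj u v), epath v u h.symm = (epath u v h).symm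
  interior_disjoint_vertices : ∀ (u v : V) (h : G.Adj u v),
      Disjoint (⇑(epath u v h) '' {t : I | t ≠ 0 ∧ t ≠ 1}) (Set.range vmap)
  interior_disjoint_edges : ∀ (u v : V) (h : G.Adj u v) (u' v' : V) (h' : G.Adj u' v'),
      s(u, v) ≠ s(u', v') →
      Disjoint (⇑(epath u v h) '' {t : I | t ≠ 0 ∧ t ≠ 1})
        (⇑(epath u' v' h') '' {t : I | t ≠ 0 ∧ t ≠ 1})

/-- The union of the images of all edge paths of a graph embedding. -/
def GraphEmbedding.edgeUnion {V X : Type*} [TopologicalSpace X] {G : SimpleGraph V}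
    (e : GraphEmbedding G X) : Set X :=
  ⋃ (u : V) (v : V) (h : G.Adj u v), Set.range ⇑(e.epath u v h)

/-- A graph embedding is setwise invariant under a homeomorphism `f` if `f` maps the set of
embedded vertices onto itself and the union of the edge paths onto itself. -/
def GraphEmbedding.SetwiseInvariant {V X : Type*} [TopologicalSpace X] {G : SimpleGraph V}
    (e : GraphEmbedding G X) (f : X ≃ₜ X) : Prop :=
  ⇑f '' Set.range e.vmap = Set.range e.vmap ∧ ⇑f '' e.edgeUnion = e.edgeUnion

open OnePoint Filter Topology

/-- A label separating unordered pairs of integers up to a common sign. -/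
noncomputable def pairLabel (a b : ℤ) : ℝ := (Encodable.encode (|a + b|, a * b) : ℝ)

lemma pairLabel_comm (a b : ℤ) : pairLabel b a = pairLabel a b := by
  simp only [pairLabel, add_comm, mul_comm]

lemma pairLabel_neg (a b : ℤ) : pairLabel (-a) (-b) = pairLabel a b := by
  have : -a + -b = -(a + b) := by ring
  simp only [pairLabel, this, abs_neg, neg_mul_neg]

lemma pairLabel_inj {a b a' b' : ℤ} (h : pairLabel a b = pairLabel a' b') :
    |a + b| = |a' + b'| ∧ a * b = a' * b' := by
  simpa [pairLabel] using h

lemma sym2_eq_of_add_eq_of_mul_eq {a b a' b' : ℤ} (hs : a + b = a' + b')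
    (hp : a * b = a' * b') : s(a, b) = s(a', b') := by
  have h : (a - a') * (a - b') = 0 := by linear_combination a * hs - hp
  rw [Sym2.eq_iff]
  rcases mul_eq_zero.mp h with h | h
  · left; constructor <;> linarith
  · right; constructor <;> linarith

/-- The point at height `c` on the vertical axis. -/
noncomputable def axisPoint (c : ℤ) : EuclideanSpace ℝ (Fin 3) := !₂[0, 0, (c : ℝ)]

/-- A parabolic arc between two points of the axis, in a half plane bounded by the axis that
depends on the unordered pair of end points; it runs inside the axis if `a + b = 0`. -/
noncomputable def pageArc (a b : ℤ) (t : ℝ) : EuclideanSpace ℝ (Fin 3) :=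
  !₂[t * (1 - t) * (a + b), t * (1 - t) * ((a + b) * pairLabel a b), (1 - t) * a + t * b]

/-- The arc from `axisPoint a` to `axisPoint (-a)` inside the axis through infinity. -/
noncomputable def outerArc (a : ℤ) (t : ℝ) : OnePoint (EuclideanSpace ℝ (Fin 3)) :=
  if 1 - 2 * t = 0 then ∞ else ((1 - 2 * t)⁻¹ • axisPoint a : EuclideanSpace ℝ (Fin 3))

/-- The arc used for an edge from `axisPoint a` to `axisPoint b`, where `N` bounds the heights
of all vertices. -/
noncomputable def edgeArc (N a b : ℤ) (t : ℝ) : OnePoint (EuclideanSpace ℝ (Fin 3)) :=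
  if a + b = 0 ∧ |a| = N then outerArc a t else (pageArc a b t : EuclideanSpace ℝ (Fin 3))

lemma axisPoint_injective : Function.Injective axisPoint := by
  intro a b h
  have := congrArg (fun p : EuclideanSpace ℝ (Fin 3) => p 2) h
  simpa [axisPoint] using this

lemma axisPoint_neg (a : ℤ) : axisPoint (-a) = -axisPoint a := by
  ext i; fin_cases i <;> simp [axisPoint]

lemma axisPoint_ne_zero {a : ℤ} (ha : a ≠ 0) : axisPoint a ≠ 0 := by
  intro h
  have := congrArg (fun p : EuclideanSpace ℝ (Fin 3) => p 2) h
  simp [axisPoint] at this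
  exact ha this

lemma continuous_pageArc (a b : ℤ) : Continuous (pageArc a b) := by
  unfold pageArc
  refine (PiLp.continuous_toLp 2 _).comp (continuous_pi fun i => ?_)
  fin_cases i <;> simp <;> fun_prop

lemma continuous_outerArc {a : ℤ} (ha : a ≠ 0) : Continuous (outerArc a) := by
  rw [continuous_iff_continuousAt]
  intro t
  by_cases ht : 1 - 2 * t = 0
  · have hval : outerArc a t = ∞ := if_pos ht
    rw [ContinuousAt, hval, OnePoint.nhds_infty_eq, coclosedCompact_eq_cocompact,
      ← Metric.cobounded_eq_cocompact]
    have hlin : Tendsto (fun s : ℝ => 1 - 2 * s) (𝓝[≠] t) (𝓝[≠] 0) := by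
      refine tendsto_nhdsWithin_iff.mpr ⟨?_, ?_⟩
      · rw [← ht]
        exact ((by fun_prop : Continuous fun s : ℝ => 1 - 2 * s).tendsto t).mono_left
          nhdsWithin_le_nhds
      · filter_upwards [self_mem_nhdsWithin] with s hs h0
        refine hs ?_
        simp only [Set.mem_singleton_iff] at h0 ⊢
        linarith
    have hcob : Tendsto (fun s : ℝ => (1 - 2 * s)⁻¹ • axisPoint a) (𝓝[≠] t)
        (Bornology.cobounded (EuclideanSpace ℝ (Fin 3))) := by
      rw [← tendsto_norm_atTop_iff_cobounded]
      simp only [norm_smul]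
      exact Tendsto.atTop_mul_const (norm_pos_iff.mpr (axisPoint_ne_zero ha))
        ((tendsto_norm_atTop_iff_cobounded.mpr tendsto_inv₀_nhdsNE_zero).comp hlin)
    rw [← nhdsNE_sup_pure, tendsto_sup]
    constructor
    · refine Tendsto.mono_right ?_ le_sup_left
      refine Tendsto.congr' ?_ (tendsto_map.comp hcob)
      filter_upwards [self_mem_nhdsWithin] with s hs
      have : 1 - 2 * s ≠ 0 := by
        intro h0
        refine hs ?_
        simp only [Set.mem_singleton_iff]
        linarith
      simp [outerArc, this]
    · refine Tendsto.mono_right ?_ le_sup_right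
      rw [tendsto_pure_left]
      intro s hs
      simpa [hval] using hs
  · have hev : ∀ᶠ s in 𝓝 t, 1 - 2 * s ≠ 0 :=
      (by fun_prop : Continuous fun s : ℝ => 1 - 2 * s).continuousAt.eventually_ne ht
    have hc : ContinuousAt (fun s : ℝ => (((1 - 2 * s)⁻¹ • axisPoint a :
        EuclideanSpace ℝ (Fin 3)) : OnePoint (EuclideanSpace ℝ (Fin 3)))) t := by
      refine OnePoint.continuous_coe.continuousAt.comp ?_
      exact ((by fun_prop : ContinuousAt (fun s : ℝ => 1 - 2 * s) t).inv₀ ht).smul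
        continuousAt_const
    refine hc.congr ?_
    filter_upwards [hev] with s hs
    simp [outerArc, hs]

lemma continuous_edgeArc {N a b : ℤ} (hab : a ≠ b) : Continuous (edgeArc N a b) := by
  by_cases h : a + b = 0 ∧ |a| = N
  · have : edgeArc N a b = outerArc a := funext fun t => if_pos h
    rw [this]
    exact continuous_outerArc (by omega)
  · have : edgeArc N a b = fun t => (pageArc a b t : OnePoint (EuclideanSpace ℝ (Fin 3))) :=
      funext fun t => if_neg h
    rw [this]
    exact OnePoint.continuous_coe.comp (continuous_pageArc a b)

lemma edgeArc_zero (N a b : ℤ) : edgeArc N a b 0 = (axisPoint a : EuclideanSpace ℝ (Fin 3)) := by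
  unfold edgeArc
  split_ifs
  · simp [outerArc]
  · simp [pageArc, axisPoint]

lemma edgeArc_one_sub (N a b : ℤ) (t : ℝ) : edgeArc N b a t = edgeArc N a b (1 - t) := by
  unfold edgeArc
  by_cases h : a + b = 0 ∧ |a| = N
  · obtain rfl : b = -a := by omega
    rw [if_pos h, if_pos ⟨by omega, by simpa using h.2⟩]
    have h1 : 1 - 2 * (1 - t) = -(1 - 2 * t) := by ring
    simp only [outerArc, h1, neg_eq_zero, axisPoint_neg, inv_neg, neg_smul, smul_neg]
  · have h' : ¬(b + a = 0 ∧ |b| = N) := by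
      rintro ⟨h0, h1⟩
      obtain rfl : b = -a := by omega
      exact h ⟨by omega, by simpa using h1⟩
    rw [if_neg h, if_neg h']
    simp only [pageArc, pairLabel_comm a b]
    congr 3
    · ring
    · congr 1
      · ring
      · congr 1; ring

lemma edgeArc_one (N a b : ℤ) : edgeArc N a b 1 = (axisPoint b : EuclideanSpace ℝ (Fin 3)) := by
  rw [edgeArc_one_sub, sub_self, edgeArc_zero]

lemma edgeArc_neg {h : OnePoint (EuclideanSpace ℝ (Fin 3)) → OnePoint (EuclideanSpace ℝ (Fin 3))}
    (hinf : h ∞ = ∞) (hcoe : ∀ p : EuclideanSpace ℝ (Fin 3), h ↑p = ↑(-p)) (N a b : ℤ) (t : ℝ) :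
    h (edgeArc N a b t) = edgeArc N (-a) (-b) t := by
  unfold edgeArc
  have hiff : (-a + -b = 0 ∧ |-a| = N) ↔ (a + b = 0 ∧ |a| = N) := by
    rw [abs_neg]
    exact and_congr_left fun _ => by omega
  simp only [hiff]
  split_ifs
  · unfold outerArc
    split_ifs
    · exact hinf
    · rw [hcoe, axisPoint_neg, smul_neg]
  · rw [hcoe, pageArc, pageArc, pairLabel_neg]
    congr 1
    ext i; fin_cases i <;> simp <;> ring

lemma edgeArc_injective {N a b : ℤ} (hab : a ≠ b) : Function.Injective (edgeArc N a b) := by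
  intro s t hst
  unfold edgeArc at hst
  split_ifs at hst with h
  · have ha : axisPoint a ≠ 0 := axisPoint_ne_zero (by omega)
    unfold outerArc at hst
    split_ifs at hst with hs ht ht
    · linarith
    · exact absurd hst.symm (OnePoint.coe_ne_infty _)
    · exact absurd hst (OnePoint.coe_ne_infty _)
    · have := inv_injective (smul_left_injective ℝ ha (OnePoint.coe_injective hst))
      linarith
  · have h2 := congrArg (fun p : EuclideanSpace ℝ (Fin 3) => p 2) (OnePoint.coe_injective hst)
    simp [pageArc] at h2
    have hab' : (b : ℝ) - a ≠ 0 := sub_ne_zero.mpr (by exact_mod_cast hab.symm)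
    refine mul_right_cancel₀ hab' ?_
    linear_combination h2

/-- An interior point of the outer arc is infinity or lies on the axis beyond height `|a|`. -/
lemma outerArc_cases {a : ℤ} (ha : a ≠ 0) {t : ℝ} (h0 : 0 < t) (h1 : t < 1) :
    outerArc a t = ∞ ∨ ∃ z : ℝ, |(a : ℝ)| < |z| ∧
      outerArc a t = (!₂[0, 0, z] : EuclideanSpace ℝ (Fin 3)) := by
  unfold outerArc
  split_ifs with h
  · exact Or.inl rfl
  · refine Or.inr ⟨(1 - 2 * t)⁻¹ * a, ?_, ?_⟩
    · rw [abs_mul, abs_inv]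
      have hpos : 0 < |(a : ℝ)| := abs_pos.mpr (by exact_mod_cast ha)
      have hlt : |1 - 2 * t| < 1 := abs_lt.mpr ⟨by linarith, by linarith⟩
      have := (one_lt_inv₀ (abs_pos.mpr h)).mpr hlt
      nlinarith
    · congr 1
      ext i; fin_cases i <;> simp [axisPoint]

/-- A page arc meeting the axis in an interior point runs inside the axis, between its ends. -/
lemma pageArc_eq_axis {a b : ℤ} (hab : a ≠ b) {t z : ℝ} (h0 : 0 < t) (h1 : t < 1)
    (h : pageArc a b t = !₂[0, 0, z]) : a + b = 0 ∧ |z| < |(a : ℝ)| := by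
  have e0 := congrArg (fun p : EuclideanSpace ℝ (Fin 3) => p 0) h
  have e2 := congrArg (fun p : EuclideanSpace ℝ (Fin 3) => p 2) h
  simp [pageArc] at e0 e2
  have hs : (a : ℝ) + b = 0 := by
    rcases e0 with (e | e) | e
    · linarith
    · linarith
    · exact e
  have hs' : a + b = 0 := by exact_mod_cast hs
  refine ⟨hs', ?_⟩
  have hz : z = (1 - 2 * t) * a := by linear_combination -e2 + t * hs
  have hpos : 0 < |(a : ℝ)| := abs_pos.mpr (by exact_mod_cast (by omega : a ≠ 0))
  have hlt : |1 - 2 * t| < 1 := abs_lt.mpr ⟨by linarith, by linarith⟩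
  rw [hz, abs_mul]
  nlinarith

lemma edgeArc_eq_axisPoint {N a b c : ℤ} (hab : a ≠ b) (hc : |c| ≤ N) {t : ℝ} (h0 : 0 < t)
    (h1 : t < 1) (h : edgeArc N a b t = (axisPoint c : EuclideanSpace ℝ (Fin 3))) :
    a + b = 0 ∧ |a| ≠ N ∧ |c| < |a| := by
  unfold edgeArc at h
  split_ifs at h with hN
  · exfalso
    rcases outerArc_cases (by omega : a ≠ 0) h0 h1 with h' | ⟨z, hz, h'⟩
    · exact OnePoint.infty_ne_coe _ (h'.symm.trans h)
    · have h2 := congrArg (fun p : EuclideanSpace ℝ (Fin 3) => p 2)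
        (OnePoint.coe_injective (h'.symm.trans h))
      simp [axisPoint] at h2
      rw [h2] at hz
      have : |a| < |c| := by exact_mod_cast hz
      omega
  · obtain ⟨hs, hz⟩ := pageArc_eq_axis hab h0 h1 (OnePoint.coe_injective h)
    exact ⟨hs, fun h' => hN ⟨hs, h'⟩, by exact_mod_cast hz⟩

lemma outerArc_ne_pageArc {a a' b' : ℤ} (ha : a ≠ 0) (hab' : a' ≠ b') (hle : |a'| ≤ |a|)
    {t t' : ℝ} (h0 : 0 < t) (h1 : t < 1) (h0' : 0 < t') (h1' : t' < 1) :
    outerArc a t ≠ (pageArc a' b' t' : EuclideanSpace ℝ (Fin 3)) := by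
  intro h
  rcases outerArc_cases ha h0 h1 with h' | ⟨z, hz, h'⟩
  · exact OnePoint.infty_ne_coe _ (h'.symm.trans h)
  · have := (pageArc_eq_axis hab' h0' h1' (OnePoint.coe_injective (h'.symm.trans h)).symm).2
    have hle' : |(a' : ℝ)| ≤ |(a : ℝ)| := by exact_mod_cast hle
    linarith

lemma pageArc_eq_pageArc {a b a' b' : ℤ} {t t' : ℝ} (h0 : 0 < t) (h1 : t < 1)
    (h0' : 0 < t') (h1' : t' < 1) (h : pageArc a b t = pageArc a' b' t') :
    s(a, b) = s(a', b') ∨ (a + b = 0 ∧ a' + b' = 0) := by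
  have e0 := congrArg (fun p : EuclideanSpace ℝ (Fin 3) => p 0) h
  have e1 := congrArg (fun p : EuclideanSpace ℝ (Fin 3) => p 1) h
  simp only [pageArc, PiLp.toLp_apply, Matrix.cons_val_zero, Matrix.cons_val_one] at e0 e1
  have hk : 0 < t * (1 - t) := mul_pos h0 (by linarith)
  have hk' : 0 < t' * (1 - t') := mul_pos h0' (by linarith)
  generalize t * (1 - t) = k at *
  generalize t' * (1 - t') = k' at *
  by_cases hs : a + b = 0
  · right
    refine ⟨hs, ?_⟩
    have hs' : (a : ℝ) + b = 0 := by exact_mod_cast hs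
    rw [hs', mul_zero, eq_comm, mul_eq_zero] at e0
    exact_mod_cast e0.resolve_left hk'.ne'
  · left
    have hs' : (a : ℝ) + b ≠ 0 := by exact_mod_cast hs
    have hl : pairLabel a b = pairLabel a' b' := by
      refine mul_left_cancel₀ (mul_ne_zero hk.ne' hs') ?_
      linear_combination e1 - pairLabel a' b' * e0
    obtain ⟨habs, hp⟩ := pairLabel_inj hl
    refine sym2_eq_of_add_eq_of_mul_eq ?_ hp
    rcases abs_eq_abs.mp habs with h | h
    · exact h
    · exfalso
      have h' : (a : ℝ) + b = -(a' + b') := by exact_mod_cast h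
      have : (k + k') * ((a : ℝ) + b) = 0 := by linear_combination e0 + k' * h'
      exact mul_ne_zero (by linarith) hs' this

lemma edgeArc_eq_edgeArc {N a b a' b' : ℤ} (hab : a ≠ b) (hab' : a' ≠ b') (ha : |a| ≤ N)
    (ha' : |a'| ≤ N) {t t' : ℝ} (h0 : 0 < t) (h1 : t < 1) (h0' : 0 < t') (h1' : t' < 1)
    (h : edgeArc N a b t = edgeArc N a' b' t') :
    s(a, b) = s(a', b') ∨ (a + b = 0 ∧ a' + b' = 0 ∧ (|a| = N ↔ |a'| = N)) := by
  unfold edgeArc at h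
  split_ifs at h with hN hN' hN'
  · exact Or.inr ⟨hN.1, hN'.1, by simp [hN.2, hN'.2]⟩
  · exact absurd h (outerArc_ne_pageArc (by omega) hab' (by omega) h0 h1 h0' h1')
  · exact absurd h.symm (outerArc_ne_pageArc (by omega) hab (by omega) h0' h1' h0 h1)
  · rcases pageArc_eq_pageArc h0 h1 h0' h1' (OnePoint.coe_injective h) with h | ⟨h, h'⟩
    · exact Or.inl h
    · exact Or.inr ⟨h, h', by tauto⟩

/-- Symmetric integer heights for the vertices of a graph yield an embedding with all vertices
on an axis that is invariant under point inversion, provided that antipodal vertices are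
adjacent only if they are the outermost ones or the innermost ones. -/
theorem exists_setwiseInvariant_of_heights {V : Type*} {G : SimpleGraph V} (k : V → ℤ)
    (hk : Function.Injective k) (N : ℤ) (hN : ∀ v, |k v| ≤ N) (τ : V → V)
    (hτk : ∀ v, k (τ v) = -k v) (hτG : ∀ u v, G.Adj u v → G.Adj (τ u) (τ v))
    (hanti : ∀ u v, G.Adj u v → k u + k v = 0 → |k u| = N ∨ ∀ w, |k u| ≤ |k w|)
    (h : OnePoint (EuclideanSpace ℝ (Fin 3)) ≃ₜ OnePoint (EuclideanSpace ℝ (Fin 3)))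
    (hinf : h ∞ = ∞) (hcoe : ∀ p : EuclideanSpace ℝ (Fin 3), h ↑p = ↑(-p)) :
    ∃ e : GraphEmbedding G (OnePoint (EuclideanSpace ℝ (Fin 3))), e.SetwiseInvariant h := by
  have hne : ∀ u v, G.Adj u v → k u ≠ k v := fun u v huv he => huv.ne (hk he)
  have hI : ∀ t : I, t ≠ 0 ∧ t ≠ 1 → 0 < (t : ℝ) ∧ (t : ℝ) < 1 := fun t ht =>
    ⟨unitInterval.pos_iff_ne_zero.mpr ht.1, unitInterval.lt_one_iff_ne_one.mpr ht.2⟩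
  have hττ : ∀ v, τ (τ v) = v := fun v => hk (by rw [hτk, hτk, neg_neg])
  have hhh : ∀ x, h (h x) = x := by
    intro x
    induction x using OnePoint.rec with
    | infty => rw [hinf, hinf]
    | coe p => rw [hcoe, hcoe, neg_neg]
  let e : GraphEmbedding G (OnePoint (EuclideanSpace ℝ (Fin 3))) :=
    { vmap := fun v => (axisPoint (k v) : EuclideanSpace ℝ (Fin 3))
      vmap_inj := fun u v huv => hk (axisPoint_injective (OnePoint.coe_injective huv))
      epath := fun u v huv =>
        { toFun := fun t => edgeArc N (k u) (k v) t
          continuous_toFun := (continuous_edgeArc (hne u v huv)).comp continuous_subtype_val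
          source' := by simp [edgeArc_zero]
          target' := by simp [edgeArc_one] }
      epath_inj := fun u v huv s t hst =>
        Subtype.ext (edgeArc_injective (hne u v huv) hst)
      epath_symm := fun u v huv => by
        ext t
        simp [Path.symm, edgeArc_one_sub N (k u) (k v)]
      interior_disjoint_vertices := by
        intro u v huv
        rw [Set.disjoint_left]
        rintro _ ⟨t, ht, rfl⟩ ⟨w, hw⟩
        obtain ⟨h0, h1⟩ := hI t ht
        obtain ⟨hs, hn, hlt⟩ := edgeArc_eq_axisPoint (hne u v huv) (hN w) h0 h1 hw.symm
        exact absurd ((hanti u v huv hs).resolve_left hn w) (not_le.mpr hlt)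
      interior_disjoint_edges := by
        intro u v huv u' v' huv' hdist
        rw [Set.disjoint_left]
        rintro _ ⟨t, ht, rfl⟩ ⟨t', ht', hw⟩
        obtain ⟨h0, h1⟩ := hI t ht
        obtain ⟨h0', h1'⟩ := hI t' ht'
        refine hdist (Sym2.map.injective hk ?_)
        rw [Sym2.map_mk, Sym2.map_mk]
        rcases edgeArc_eq_edgeArc (hne u v huv) (hne u' v' huv') (hN u) (hN u') h0 h1 h0' h1'
          hw.symm with h | ⟨hs, hs', hiff⟩
        · exact h
        · have habs : |k u| = |k u'| := by
            by_cases hu : |k u| = N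
            · rw [hu, hiff.mp hu]
            · exact le_antisymm ((hanti u v huv hs).resolve_left hu u')
                ((hanti u' v' huv' hs').resolve_left (fun h => hu (hiff.mpr h)) u)
          rw [Sym2.eq_iff]
          rcases abs_eq_abs.mp habs with h | h <;> omega }
  have hv : ∀ x ∈ Set.range e.vmap, h x ∈ Set.range e.vmap := by
    rintro _ ⟨v, rfl⟩
    exact ⟨τ v, by simp only [e, hτk, axisPoint_neg, hcoe]⟩
  have hE : ∀ x ∈ e.edgeUnion, h x ∈ e.edgeUnion := by
    intro x hx
    simp only [GraphEmbedding.edgeUnion, Set.mem_iUnion] at hx ⊢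
    obtain ⟨u, v, huv, t, rfl⟩ := hx
    refine ⟨τ u, τ v, hτG u v huv, t, ?_⟩
    change edgeArc N (k (τ u)) (k (τ v)) t = h (edgeArc N (k u) (k v) t)
    rw [edgeArc_neg hinf hcoe, hτk, hτk]
  have himage : ∀ S : Set (OnePoint (EuclideanSpace ℝ (Fin 3))), (∀ x ∈ S, h x ∈ S) →
      h '' S = S := fun S hS =>
    Set.Subset.antisymm (Set.image_subset_iff.mpr hS) fun x hx => ⟨h x, hS x hx, hhh x⟩
  exact ⟨e, himage _ hv, himage _ hE⟩

/-- A finite graph with an involutive automorphism that has at most one fixed vertex embeds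
invariantly if each vertex adjacent to its image has, together with that image, the strictly
largest rank, or the strictly smallest rank with no vertex being fixed. -/
theorem exists_setwiseInvariant_of_involutive {V : Type*} [Finite V] {G : SimpleGraph V}
    (τ : V → V) (hτ : Function.Involutive τ) (hτG : ∀ u v, G.Adj u v → G.Adj (τ u) (τ v))
    (hfix : ∀ u v, τ u = u → τ v = v → u = v) (ρ : V → ℕ) (hρ : ∀ v, ρ (τ v) = ρ v)
    (hanti : ∀ v, G.Adj v (τ v) → (∀ w, w = v ∨ w = τ v ∨ ρ w < ρ v) ∨
      ∀ w, τ w ≠ w ∧ (w = v ∨ w = τ v ∨ ρ v < ρ w))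
    (h : OnePoint (EuclideanSpace ℝ (Fin 3)) ≃ₜ OnePoint (EuclideanSpace ℝ (Fin 3)))
    (hinf : h ∞ = ∞) (hcoe : ∀ p : EuclideanSpace ℝ (Fin 3), h ↑p = ↑(-p)) :
    ∃ e : GraphEmbedding G (OnePoint (EuclideanSpace ℝ (Fin 3))), e.SetwiseInvariant h := by
  obtain ⟨M, ⟨e₀⟩⟩ := Finite.exists_equiv_fin V
  obtain ⟨e, heinj, hpos, hmono⟩ : ∃ e : V → ℤ, Function.Injective e ∧ (∀ v, 0 < e v) ∧
      ∀ u v, ρ u < ρ v → e u < e v := by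
    refine ⟨fun v => ((e₀ v + M * ρ v : ℕ) : ℤ) + 1, ?_, fun v => by positivity, ?_⟩
    · intro u v huv
      have h1 : (e₀ u + M * ρ u : ℕ) = e₀ v + M * ρ v := by
        simp only at huv
        omega
      have h2 := congrArg (· % M) h1
      simp only [Nat.add_mul_mod_self_left, Nat.mod_eq_of_lt (e₀ _).isLt] at h2
      exact e₀.injective (Fin.ext h2)
    · intro u v huv
      have h1 : M * (ρ u + 1) ≤ M * ρ v := Nat.mul_le_mul_left M huv
      have h2 := (e₀ u).isLt
      simp only
      rw [mul_add] at h1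
      omega
  let k : V → ℤ := fun v =>
    if e (τ v) < e v then e (τ v) else if e v < e (τ v) then -e v else 0
  have hk0 : ∀ v, (τ v = v ∧ k v = 0) ∨ (e (τ v) < e v ∧ k v = e (τ v)) ∨
      (e v < e (τ v) ∧ k v = -e v) := by
    intro v
    rcases lt_trichotomy (e v) (e (τ v)) with hlt | heq | hlt
    · exact Or.inr (Or.inr ⟨hlt, by simp only [k]; rw [if_neg hlt.not_gt, if_pos hlt]⟩)
    · refine Or.inl ⟨(heinj heq).symm, by simp [k, ← heq]⟩
    · exact Or.inr (Or.inl ⟨hlt, by simp only [k]; rw [if_pos hlt]⟩)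
  have hτk : ∀ v, k (τ v) = -k v := by
    intro v
    have h1 := hk0 v
    have h2 := hk0 (τ v)
    rw [hτ v] at h2
    rcases h1 with ⟨h, h'⟩ | h1 | h1
    · rw [h, h', neg_zero]
    · rcases h2 with ⟨h, h'⟩ | h2 | h2
      · rw [← h] at h1; omega
      · omega
      · omega
    · rcases h2 with ⟨h, h'⟩ | h2 | h2
      · rw [← h] at h1; omega
      · omega
      · omega
  have habs : ∀ v, (τ v = v ∧ |k v| = 0) ∨ |k v| = min (e v) (e (τ v)) := by
    intro v
    have := hpos v
    have := hpos (τ v)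
    rcases hk0 v with ⟨h, h'⟩ | ⟨h, h'⟩ | ⟨h, h'⟩
    · exact Or.inl ⟨h, by simp [h']⟩
    · right; rw [h', abs_of_pos (by omega), min_eq_right h.le]
    · right; rw [h', abs_neg, abs_of_pos (by omega), min_eq_left h.le]
  have hkinj : Function.Injective k := by
    intro u v huv
    have := hpos u
    have := hpos v
    have := hpos (τ u)
    have := hpos (τ v)
    rcases hk0 u with ⟨h, h'⟩ | ⟨h, h'⟩ | ⟨h, h'⟩ <;>
      rcases hk0 v with ⟨g, g'⟩ | ⟨g, g'⟩ | ⟨g, g'⟩ <;> try omega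
    · exact hfix u v h g
    · exact hτ.injective (heinj (by omega))
    · exact heinj (by omega)
  obtain ⟨N, hN, hNmax⟩ : ∃ N : ℤ, (∀ v, |k v| ≤ N) ∧
      ∀ v, (∀ w, |k w| ≤ |k v|) → |k v| = N := by
    rcases isEmpty_or_nonempty V with hV | hV
    · exact ⟨0, fun v => hV.elim v, fun v => hV.elim v⟩
    · obtain ⟨v₀, hv₀⟩ := Finite.exists_max fun v => |k v|
      exact ⟨|k v₀|, hv₀, fun v hv => le_antisymm (hv₀ v) (hv v₀)⟩
  refine exists_setwiseInvariant_of_heights k hkinj N hN τ hτk hτG ?_ h hinf hcoe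
  intro u v huv hsum
  obtain rfl : v = τ u := hkinj (by rw [hτk]; omega)
  have hτabs : |k (τ u)| = |k u| := by rw [hτk, abs_neg]
  have hu : |k u| = min (e u) (e (τ u)) :=
    (habs u).resolve_left fun h => huv.ne h.1.symm
  rcases hanti u huv with hout | hinn
  · refine Or.inl (hNmax u fun w => ?_)
    rcases hout w with rfl | rfl | hw
    · exact le_rfl
    · exact hτabs.le
    · have h1 := hmono w u hw
      have h2 := hmono w (τ u) (by rwa [hρ])
      have := hpos w
      rcases habs w with ⟨_, h'⟩ | h' <;> omega
  · refine Or.inr fun w => ?_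
    obtain ⟨hne, rfl | rfl | hw⟩ := hinn w
    · exact le_rfl
    · exact hτabs.ge
    · have h1 := hmono u w hw
      have h2 := hmono u (τ w) (by rwa [hρ])
      have h3 := (habs w).resolve_left fun h => hne h.1
      omega

/-- The special case of a complete multipartite graph whose parts are permuted by an involution
`π` that moves only parts with one vertex, the order of each part being reversed. -/
theorem exists_setwiseInvariant_completeMultipartiteGraph {κ : Type} [Finite κ] (n : κ → ℕ)
    (π : κ → κ) (hπ : Function.Involutive π) (hn : ∀ x, n (π x) = n x)
    (hone : ∀ x, π x ≠ x → n x = 1)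
    (hodd : ∀ x y, π x = x → π y = y → Odd (n x) → Odd (n y) → x = y)
    (ρ : κ → ℕ) (hρ : ∀ x, ρ (π x) = ρ x)
    (hanti : ∀ x, π x ≠ x → (∀ y, y = x ∨ y = π x ∨ ρ y < ρ x) ∨
      ((∀ y, π y = y → Even (n y)) ∧ ∀ y, y = x ∨ y = π x ∨ ρ x < ρ y))
    (h : OnePoint (EuclideanSpace ℝ (Fin 3)) ≃ₜ OnePoint (EuclideanSpace ℝ (Fin 3)))
    (hinf : h ∞ = ∞) (hcoe : ∀ p : EuclideanSpace ℝ (Fin 3), h ↑p = ↑(-p)) :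
    ∃ e : GraphEmbedding (SimpleGraph.completeMultipartiteGraph fun x => Fin (n x))
      (OnePoint (EuclideanSpace ℝ (Fin 3))), e.SetwiseInvariant h := by
  have hext : ∀ v w : Σ x, Fin (n x), v.1 = w.1 → (v.2 : ℕ) = w.2 → v = w := by
    rintro ⟨x, i⟩ ⟨y, j⟩ hxy hij
    obtain rfl : x = y := hxy
    exact congrArg (Sigma.mk x) (Fin.ext hij)
  let τ : (Σ x, Fin (n x)) → Σ x, Fin (n x) := fun v => ⟨π v.1, (v.2.rev).cast (hn v.1).symm⟩
  have hτval : ∀ v, ((τ v).2 : ℕ) = n v.1 - (v.2 + 1) := fun v => by simp [τ, Fin.val_rev]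
  have hfix : ∀ v, τ v = v → π v.1 = v.1 ∧ n v.1 = 2 * v.2 + 1 := by
    intro v hv
    refine ⟨congrArg Sigma.fst hv, ?_⟩
    have h1 := hτval v
    rw [hv] at h1
    have := v.2.isLt
    omega
  have hsingle : ∀ v w : Σ x, Fin (n x), π v.1 ≠ v.1 →
      (w.1 = v.1 → w = v) ∧ (w.1 = π v.1 → w = τ v) := by
    intro v w hv
    have h1 := hone v.1 hv
    have h2 := hn v.1
    refine ⟨fun hw => hext _ _ hw ?_, fun hw => hext _ _ hw ?_⟩
    · have := w.2.isLt
      have := v.2.isLt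
      have : n w.1 = n v.1 := congrArg n hw
      omega
    · have := w.2.isLt
      have : ((τ v).2 : ℕ) < n (π v.1) := (τ v).2.isLt
      have : n w.1 = n (π v.1) := congrArg n hw
      omega
  refine exists_setwiseInvariant_of_involutive τ ?_ ?_ ?_ (fun v => ρ v.1) (fun v => hρ v.1) ?_
    h hinf hcoe
  · intro v
    refine hext _ _ (hπ v.1) ?_
    have h1 := hτval (τ v)
    rw [hτval v, show n (τ v).1 = n v.1 from hn v.1] at h1
    have := v.2.isLt
    omega
  · intro u v huv
    exact fun he => huv (hπ.injective he)
  · intro u v hu hv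
    obtain ⟨hu1, hu2⟩ := hfix u hu
    obtain ⟨hv1, hv2⟩ := hfix v hv
    have hxy := hodd u.1 v.1 hu1 hv1 ⟨_, hu2⟩ ⟨_, hv2⟩
    refine hext _ _ hxy ?_
    have := congrArg n hxy
    omega
  · intro v hv
    have hv' : π v.1 ≠ v.1 := fun he => hv he.symm
    rcases hanti v.1 hv' with hout | ⟨heven, hinn⟩
    · refine Or.inl fun w => ?_
      rcases hout w.1 with hw | hw | hw
      · exact Or.inl ((hsingle v w hv').1 hw)
      · exact Or.inr (Or.inl ((hsingle v w hv').2 hw))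
      · exact Or.inr (Or.inr hw)
    · refine Or.inr fun w => ⟨fun hw => ?_, ?_⟩
      · obtain ⟨h1, h2⟩ := hfix w hw
        exact Nat.not_even_iff_odd.mpr ⟨_, h2⟩ (heven w.1 h1)
      · rcases hinn w.1 with hw | hw | hw
        · exact Or.inl ((hsingle v w hv').1 hw)
        · exact Or.inr (Or.inl ((hsingle v w hv').2 hw))
        · exact Or.inr (Or.inr hw)

/-- A complete multipartite graph of the form $G + K_{q_1,q_2,q_3,q_4}$, where every partite set
of $G$ has even size and one of the four listed conditions holds, admits an embedding in
$S^3 = \mathbb{R}^3 \cup \{\infty\}$ that is setwise invariant under the point inversion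
$h(x) = -x$, $h(\infty) = \infty$. -/
theorem multipartite_achiral_2 {ι : Type} [Fintype ι] (m : ι → ℕ) (q : Fin 4 → ℕ)
    (hGeven : ∀ i, Even (m i))
    (hcond :
      -- (1) all qᵢ = 0
      (∀ i, q i = 0) ∨
      -- (2) one qᵢ is odd and all other qᵢ = 0
      (∃ i, Odd (q i) ∧ ∀ j, j ≠ i → q j = 0) ∨
      -- (3) two qᵢ = 1, one qᵢ = 0, and the last qᵢ is either odd or 0
      (∃ i j k l : Fin 4, i ≠ j ∧ i ≠ k ∧ i ≠ l ∧ j ≠ k ∧ j ≠ l ∧ k ≠ l ∧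
        q i = 1 ∧ q j = 1 ∧ q k = 0 ∧ (Odd (q l) ∨ q l = 0)) ∨
      -- (4) all qᵢ = 1
      (∀ i, q i = 1))
    (h : OnePoint (EuclideanSpace ℝ (Fin 3)) ≃ₜ OnePoint (EuclideanSpace ℝ (Fin 3)))
    (hinf : h OnePoint.infty = OnePoint.infty)
    (hcoe : ∀ p : EuclideanSpace ℝ (Fin 3), h ↑p = ↑(-p)) :
    ∃ e : GraphEmbedding
        (SimpleGraph.completeMultipartiteGraph
          (Sum.elim (fun a : ι => Fin (m a)) (fun i : Fin 4 => Fin (q i))))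
        (OnePoint (EuclideanSpace ℝ (Fin 3))),
      e.SetwiseInvariant h := by
  have hfun : (Sum.elim (fun a : ι => Fin (m a)) (fun i : Fin 4 => Fin (q i))) =
      fun x => Fin (Sum.elim m q x) := by
    funext x; cases x <;> rfl
  rw [hfun]
  have key : ∀ (f : Fin 4 → Fin 4) (r : Fin 4 → ℕ), Function.Involutive f →
      (∀ x, q (f x) = q x) → (∀ x, f x ≠ x → q x = 1) →
      (∀ x y, f x = x → f y = y → Odd (q x) → Odd (q y) → x = y) → (∀ x, r (f x) = r x) →
      (∀ x, f x ≠ x → (1 < r x ∧ ∀ y, y = x ∨ y = f x ∨ r y < r x) ∨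
        (r x < 1 ∧ (∀ y, f y = y → Even (q y)) ∧ ∀ y, y = x ∨ y = f x ∨ r x < r y)) →
      ∃ e : GraphEmbedding (SimpleGraph.completeMultipartiteGraph
          fun x => Fin (Sum.elim m q x)) (OnePoint (EuclideanSpace ℝ (Fin 3))),
        e.SetwiseInvariant h := by
    intro f r hf hq hone hodd hr hanti
    refine exists_setwiseInvariant_completeMultipartiteGraph (Sum.elim m q) (Sum.map id f)
      ?_ ?_ ?_ ?_ (Sum.elim (fun _ => 1) r) ?_ ?_ h hinf hcoe
    · rintro (x | x)
      · rfl
      · exact congrArg Sum.inr (hf x)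
    · rintro (x | x) <;> simp [hq]
    · rintro (x | x) hx
      · simp at hx
      · exact hone x (by simpa using hx)
    · rintro (x | x) (y | y) hx hy ox oy
      · exact absurd (hGeven x) (Nat.not_even_iff_odd.mpr ox)
      · exact absurd (hGeven x) (Nat.not_even_iff_odd.mpr ox)
      · exact absurd (hGeven y) (Nat.not_even_iff_odd.mpr oy)
      · exact congrArg Sum.inr (hodd x y (by simpa using hx) (by simpa using hy) ox oy)
    · rintro (x | x) <;> simp [hr]
    · rintro (x | x) hx
      · simp at hx
      · rcases hanti x (by simpa using hx) with ⟨h1, h2⟩ | ⟨h1, h2, h3⟩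
        · left
          rintro (y | y)
          · simpa using h1
          · simpa using h2 y
        · right
          constructor
          · rintro (y | y) hy
            · exact hGeven y
            · exact h2 y (by simpa using hy)
          · rintro (y | y)
            · simpa using h1
            · simpa using h3 y
  rcases hcond with hq | ⟨i, -, hq⟩ | ⟨i, j, k, l, hij, hik, hil, hjk, hjl, hkl, hi, hj, hk, -⟩ | hq
  · exact key id (fun _ => 1) (fun _ => rfl) (fun _ => rfl) (fun x hx => absurd rfl hx)
      (fun x _ _ _ hx => by simp [hq] at hx) (fun _ => rfl) (fun x hx => absurd rfl hx)
  · have hodd : ∀ x, Odd (q x) → x = i := fun x hx => by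
      by_contra hxi
      simp [hq x hxi] at hx
    exact key id (fun _ => 1) (fun _ => rfl) (fun _ => rfl) (fun x hx => absurd rfl hx)
      (fun x y _ _ hx hy => (hodd x hx).trans (hodd y hy).symm) (fun _ => rfl)
      (fun x hx => absurd rfl hx)
  · have hall : ∀ x, x = i ∨ x = j ∨ x = k ∨ x = l := by omega
    have hfi : Equiv.swap i j i = j := Equiv.swap_apply_left i j
    have hfj : Equiv.swap i j j = i := Equiv.swap_apply_right i j
    have hfk : Equiv.swap i j k = k := Equiv.swap_apply_of_ne_of_ne hik.symm hjk.symm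
    have hfl : Equiv.swap i j l = l := Equiv.swap_apply_of_ne_of_ne hil.symm hjl.symm
    refine key (Equiv.swap i j) (fun x => if x = i ∨ x = j then 2 else 1)
      (Equiv.swap_apply_self i j) ?_ ?_ ?_ ?_ ?_
    · intro x
      rcases hall x with rfl | rfl | rfl | rfl
      · rw [hfi, hi, hj]
      · rw [hfj, hi, hj]
      · rw [hfk]
      · rw [hfl]
    · intro x hx
      rcases hall x with rfl | rfl | rfl | rfl
      · exact hi
      · exact hj
      · exact absurd hfk hx
      · exact absurd hfl hx
    · have hfix : ∀ x, Equiv.swap i j x = x → Odd (q x) → x = l := by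
        intro x hx ox
        rcases hall x with rfl | rfl | rfl | rfl
        · exact absurd (hfi.symm.trans hx).symm hij
        · exact absurd (hfj.symm.trans hx) hij
        · simp [hk] at ox
        · rfl
      exact fun x y hx hy ox oy => (hfix x hx ox).trans (hfix y hy oy).symm
    · intro x
      rcases hall x with rfl | rfl | rfl | rfl
      · simp only [hfi, true_or, or_true]
      · simp only [hfj, true_or, or_true]
      · rw [hfk]
      · rw [hfl]
    · intro x hx
      left
      have hx' : x = i ∨ x = j := by
        rcases hall x with rfl | rfl | rfl | rfl
        · exact Or.inl rfl
        · exact Or.inr rfl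
        · exact absurd hfk hx
        · exact absurd hfl hx
      simp only [if_pos hx']
      refine ⟨one_lt_two, fun y => ?_⟩
      by_cases hy : y = i ∨ y = j
      · rcases hx' with rfl | rfl
        · rw [hfi]; tauto
        · rw [hfj]; tauto
      · simp [hy]
  · have hmoved : ∀ x : Fin 4, (![1, 0, 3, 2] : Fin 4 → Fin 4) x ≠ x := by decide
    refine key ![1, 0, 3, 2] ![0, 0, 2, 2] (by unfold Function.Involutive; decide)
      (fun _ => by rw [hq, hq]) (fun x _ => hq x)
      (fun x _ hx => absurd hx (hmoved x)) (by decide) ?_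
    · intro x _
      have : ∀ x : Fin 4, (1 < (![0, 0, 2, 2] : Fin 4 → ℕ) x ∧
          ∀ y, y = x ∨ y = (![1, 0, 3, 2] : Fin 4 → Fin 4) x ∨
            (![0, 0, 2, 2] : Fin 4 → ℕ) y < (![0, 0, 2, 2] : Fin 4 → ℕ) x) ∨
          ((![0, 0, 2, 2] : Fin 4 → ℕ) x < 1 ∧
          ∀ y, y = x ∨ y = (![1, 0, 3, 2] : Fin 4 → Fin 4) x ∨
            (![0, 0, 2, 2] : Fin 4 → ℕ) x < (![0, 0, 2, 2] : Fin 4 → ℕ) y) := by decide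
      exact (this x).imp_right fun h => ⟨h.1, fun y hy => absurd hy (hmoved y), h.2⟩
end

section
/- Let W₁ and W₂ be disjoint nonempty finite sets of equal odd cardinality, and let σ be a permutation of W₁ ∪ W₂ with σ(W₁) = W₂ whose order is a power of 2. Then there exists w₁ ∈ W₁ such that σ(w₁) ∈ W₂ and σ(σ(w₁)) = w₁; that is, σ has a 2-cycle consisting of one element of W₁ and one element of W₂. -/
/-- Let `W₁` and `W₂` be disjoint nonempty finite sets of equal odd cardinality whose union is
the whole (finite) ambient set, and let `σ` be a permutation of the ambient set with
`σ(W₁) = W₂` whose order is a power of 2.  Then `σ` has a 2-cycle consisting of one element of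
`W₁` and one element of `W₂`. -/
theorem exists_two_cycle_of_odd_interchanged {α : Type*} [Fintype α] [DecidableEq α]
    (W₁ W₂ : Finset α) (hdisj : Disjoint W₁ W₂)
    (hne₁ : W₁.Nonempty) (hne₂ : W₂.Nonempty)
    (hcard : W₁.card = W₂.card) (hodd : Odd W₁.card)
    (hunion : W₁ ∪ W₂ = Finset.univ)
    (σ : Equiv.Perm α) (himage : W₁.image ⇑σ = W₂)
    (horder : ∃ k : ℕ, orderOf σ = 2 ^ k) :
    ∃ w₁ ∈ W₁, σ w₁ ∈ W₂ ∧ σ (σ w₁) = w₁ := by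
  obtain ⟨k, hk⟩ := horder
  have mem_image (x : α) : σ x ∈ W₂ ↔ x ∈ W₁ := by
    rw [← himage, σ.injective.mem_finset_image]
  have mem_swap (x : α) : σ x ∈ W₁ ↔ x ∉ W₁ := by
    rw [← mem_image x]
    refine ⟨fun h₁ h₂ => Finset.disjoint_left.mp hdisj h₁ h₂, fun h => ?_⟩
    have hx : σ x ∈ W₁ ∪ W₂ := hunion ▸ Finset.mem_univ _
    exact (Finset.mem_union.mp hx).resolve_right h
  have mem_sq (x : α) : (σ ^ 2) x ∈ W₁ ↔ x ∈ W₁ := by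
    rw [sq, Equiv.Perm.mul_apply, mem_swap, mem_swap, not_not]
  have hpow : ((σ ^ 2).subtypePerm mem_sq) ^ 2 ^ k = 1 := by
    have hσ : (σ ^ 2) ^ 2 ^ k = 1 := by
      rw [← pow_mul, mul_comm, pow_mul, ← hk, pow_orderOf_eq_one, one_pow]
    ext x
    simp [Equiv.Perm.subtypePerm_pow, hσ]
  have : Fact (Nat.Prime 2) := ⟨Nat.prime_two⟩
  obtain ⟨⟨w, hw⟩, hfix⟩ := Equiv.Perm.exists_fixed_point_of_prime (p := 2)
    (by simpa using hodd.not_two_dvd_nat) hpow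
  exact ⟨w, hw, (mem_image w).mpr hw, congrArg Subtype.val hfix⟩
end

section
/- Let γ be a complete multipartite graph with nonempty partite sets, and let σ be an involution of the vertex set of γ that maps each partite set onto a partite set. Assume: (a) there is no pair of adjacent vertices both fixed by σ; and (b) the number of vertices fixed by σ plus the number of unordered pairs {v, σ(v)} with σ(v) ≠ v and v adjacent to σ(v) is at most 2. Then: γ has at most one partite set of odd size at least 3; γ has at most four partite sets of size 1; and if γ has a partite set of odd size at least 3, then the number of partite sets of size 1 is either 0 or 2. -/
open Finset in
/-- A finite set carrying a fixed-point-free involution has even cardinality. -/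
theorem Finset.even_card_of_involution {α : Type*} (s : Finset α) (f : α → α)
    (hmem : ∀ a ∈ s, f a ∈ s) (hne : ∀ a ∈ s, f a ≠ a) (hinv : ∀ a ∈ s, f (f a) = a) :
    Even #s := by
  have h : ∑ _a ∈ s, (1 : ZMod 2) = 0 :=
    Finset.sum_involution (fun a _ => f a) (fun _ _ => by decide) (fun a ha _ => hne a ha)
      (fun a ha => hmem a ha) (fun a ha => hinv a ha)
  rw [← ZMod.natCast_eq_zero_iff_even]
  simpa using h

open Finset in
/-- An involution of a finite set of odd cardinality has a fixed point. -/
theorem Finset.exists_fixed_of_odd_card {α : Type*} (s : Finset α) (f : α → α)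
    (hmem : ∀ a ∈ s, f a ∈ s) (hinv : ∀ a ∈ s, f (f a) = a) (hodd : Odd #s) :
    ∃ a ∈ s, f a = a := by
  by_contra! hne
  exact Nat.not_even_iff_odd.2 hodd (s.even_card_of_involution f hmem hne hinv)

open Finset in
/-- Let `γ` be the complete multipartite graph on nonempty partite sets `V i`, and let `σ` be an
involution of its vertex set mapping each partite set onto a partite set.  Assume (a) no pair of
adjacent vertices is fixed by `σ`, and (b) the number of fixed vertices plus the number of
unordered pairs `{v, σ v}` of adjacent interchanged vertices is at most 2.  Then `γ` has at most
one partite set of odd size at least 3, at most four partite sets of size 1, and if it has a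
partite set of odd size at least 3 then the number of partite sets of size 1 is 0 or 2. -/
theorem involution_constraints {ι : Type*} [Fintype ι] (V : ι → Type*)
    [∀ i, Fintype (V i)] [∀ i, Nonempty (V i)]
    (σ : Equiv.Perm (Σ i, V i))
    (hinv : ∀ v, σ (σ v) = v)
    (hparts : ∀ i : ι, ∃ j : ι, ⇑σ '' {p : Σ i, V i | p.1 = i} = {p : Σ i, V i | p.1 = j})
    (hfix : ∀ u v : Σ i, V i, (SimpleGraph.completeMultipartiteGraph V).Adj u v →
      σ u = u → σ v ≠ v)
    (hcount : Nat.card {v : Σ i, V i // σ v = v} +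
      Nat.card {v : Σ i, V i // σ v ≠ v ∧ (SimpleGraph.completeMultipartiteGraph V).Adj v (σ v)} / 2
        ≤ 2) :
    (∀ i j : ι, (Odd (Fintype.card (V i)) ∧ 3 ≤ Fintype.card (V i)) →
      (Odd (Fintype.card (V j)) ∧ 3 ≤ Fintype.card (V j)) → i = j) ∧
    Nat.card {i : ι // Fintype.card (V i) = 1} ≤ 4 ∧
    ((∃ i : ι, Odd (Fintype.card (V i)) ∧ 3 ≤ Fintype.card (V i)) →
      Nat.card {i : ι // Fintype.card (V i) = 1} = 0 ∨
      Nat.card {i : ι // Fintype.card (V i) = 1} = 2) := by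
  classical
  have hfst : ∀ u v : Σ i, V i, u.1 = v.1 → (σ u).1 = (σ v).1 := by
    intro u v huv
    obtain ⟨j, hj⟩ := hparts v.1
    have hu : σ u ∈ {p : Σ i, V i | p.1 = j} := hj ▸ Set.mem_image_of_mem σ huv
    have hv : σ v ∈ {p : Σ i, V i | p.1 = j} := hj ▸ Set.mem_image_of_mem σ rfl
    exact hu.trans hv.symm
  obtain ⟨τ, hτ⟩ : ∃ τ : ι → ι, ∀ v, (σ v).1 = τ v.1 :=
    ⟨fun i => (σ ⟨i, Classical.arbitrary (V i)⟩).1, fun v => hfst _ _ rfl⟩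
  have hττ : ∀ i, τ (τ i) = i := by
    intro i
    have h := hτ (σ ⟨i, Classical.arbitrary (V i)⟩)
    rw [hinv, hτ] at h
    exact h.symm
  let P : ι → Finset (Σ i, V i) := fun i => univ.filter fun v => v.1 = i
  have hP : ∀ i, #(P i) = Fintype.card (V i) := by
    intro i
    have : P i = univ.map (Function.Embedding.sigmaMk i) := by
      ext ⟨j, x⟩
      simp only [P, mem_filter, mem_univ, true_and, mem_map, Function.Embedding.sigmaMk_apply]
      constructor
      · rintro rfl
        exact ⟨x, rfl⟩
      · rintro ⟨y, hy⟩
        exact (congrArg Sigma.fst hy).symm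
    rw [this, card_map, card_univ]
  have hcard : ∀ i, Fintype.card (V (τ i)) = Fintype.card (V i) := by
    intro i
    rw [← hP, ← hP]
    refine card_bij (fun v _ => σ v) ?_ (fun _ _ _ _ h => σ.injective h) ?_
    · intro v hv
      simp only [P, mem_filter, mem_univ, true_and] at hv ⊢
      rw [hτ, hv, hττ]
    · intro v hv
      simp only [P, mem_filter, mem_univ, true_and] at hv
      exact ⟨σ v, by simp [P, hτ, hv], hinv v⟩
  have hfixed : ∀ i, Odd (Fintype.card (V i)) → τ i = i → ∃ v : Σ i, V i, v.1 = i ∧ σ v = v := by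
    intro i hodd hi
    obtain ⟨v, hv, hσv⟩ := (P i).exists_fixed_of_odd_card σ
      (fun v hv => by
        simp only [P, mem_filter, mem_univ, true_and] at hv ⊢
        rw [hτ, hv, hi])
      (fun v _ => hinv v) ((hP i).symm ▸ hodd)
    exact ⟨v, (mem_filter.1 hv).2, hσv⟩
  have hunique : ∀ i j, Odd (Fintype.card (V i)) → Odd (Fintype.card (V j)) →
      τ i = i → τ j = j → i = j := by
    intro i j hi hj hτi hτj
    obtain ⟨u, rfl, hu⟩ := hfixed i hi hτi
    obtain ⟨v, rfl, hv⟩ := hfixed j hj hτj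
    by_contra hne
    exact hfix u v hne hu hv
  have hpos : ∀ i, Odd (Fintype.card (V i)) → τ i = i →
      1 ≤ Nat.card {v : Σ i, V i // σ v = v} := by
    intro i hi hτi
    obtain ⟨v, -, hv⟩ := hfixed i hi hτi
    exact Nat.card_pos_iff.2 ⟨⟨⟨v, hv⟩⟩, inferInstance⟩
  let B : Finset ι := univ.filter fun i => τ i ≠ i
  have hmoved : Nat.card {v : Σ i, V i // σ v ≠ v ∧
      (SimpleGraph.completeMultipartiteGraph V).Adj v (σ v)} =
      ∑ i ∈ B, Fintype.card (V i) := by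
    have : (univ.filter fun v : Σ i, V i => σ v ≠ v ∧
        (SimpleGraph.completeMultipartiteGraph V).Adj v (σ v)) = B.sigma fun _ => univ := by
      ext v
      have hadj : (SimpleGraph.completeMultipartiteGraph V).Adj v (σ v) ↔ v.1 ≠ (σ v).1 := Iff.rfl
      simp only [mem_filter, mem_univ, true_and, mem_sigma, and_true, B, hadj, hτ]
      refine ⟨fun h => h.2.symm, fun h => ⟨fun hv => h ?_, h.symm⟩⟩
      rw [← hτ, hv]
    rw [Nat.card_eq_fintype_card, Fintype.card_subtype, this, card_sigma]
    simp
  rw [hmoved] at hcount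
  have hstable : ∀ i, Odd (Fintype.card (V i)) ∧ 3 ≤ Fintype.card (V i) → τ i = i := by
    rintro i ⟨-, hi⟩
    by_contra hne
    have hsub : {i, τ i} ⊆ B := by
      intro j hj
      rcases mem_insert.1 hj with rfl | hj
      · simpa [B] using hne
      · rw [mem_singleton.1 hj]
        simpa [B, hττ] using Ne.symm hne
    have hle := sum_le_sum_of_subset (f := fun i => Fintype.card (V i)) hsub
    rw [sum_pair (Ne.symm hne), hcard] at hle
    omega
  let A : Finset ι := univ.filter fun i => Fintype.card (V i) = 1 ∧ τ i ≠ i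
  have hA_even : Even #A := by
    refine A.even_card_of_involution τ (fun i hi => ?_) (fun i hi => (mem_filter.1 hi).2.2)
      (fun i _ => hττ i)
    simp only [A, mem_filter, mem_univ, true_and] at hi ⊢
    exact ⟨(hcard i).trans hi.1, by rw [hττ]; exact hi.2.symm⟩
  have hA_le : #A ≤ ∑ i ∈ B, Fintype.card (V i) := by
    have hsub : A ⊆ B := fun i hi => mem_filter.2 ⟨mem_univ i, (mem_filter.1 hi).2.2⟩
    calc #A ≤ #B := card_le_card hsub
      _ = ∑ i ∈ B, 1 := card_eq_sum_ones B
      _ ≤ ∑ i ∈ B, Fintype.card (V i) := sum_le_sum fun i _ => Fintype.card_pos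
  let C : Finset ι := univ.filter fun i => Fintype.card (V i) = 1 ∧ τ i = i
  have hsingle : Nat.card {i : ι // Fintype.card (V i) = 1} = #A + #C := by
    rw [Nat.card_eq_fintype_card, Fintype.card_subtype,
      ← card_filter_add_card_filter_not (fun i => τ i ≠ i)]
    simp [A, C, filter_filter]
  have hodd : ∀ i ∈ C, Odd (Fintype.card (V i)) := fun i hi => by simp [(mem_filter.1 hi).2.1]
  have hC_le : #C ≤ 1 := card_le_one.2 fun i hi j hj =>
    hunique i j (hodd i hi) (hodd j hj) (mem_filter.1 hi).2.2 (mem_filter.1 hj).2.2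
  obtain ⟨k, hk⟩ := hA_even
  refine ⟨fun i j hi hj => hunique i j hi.1 hj.1 (hstable i hi) (hstable j hj), ?_, ?_⟩
  · rcases C.eq_empty_or_nonempty with hC | ⟨i, hi⟩
    · rw [hC, card_empty] at hsingle
      omega
    · have := hpos i (hodd i hi) (mem_filter.1 hi).2.2
      omega
  · rintro ⟨i, hi⟩
    have hτi := hstable i hi
    have hC : C = ∅ := by
      refine eq_empty_of_forall_notMem fun j hj => ?_
      have hji := hunique j i (hodd j hj) hi.1 (mem_filter.1 hj).2.2 hτi
      have := (mem_filter.1 hj).2.1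
      rw [hji] at this
      omega
    have := hpos i hi.1 hτi
    rw [hC, card_empty] at hsingle
    omega
end

section
/- Let v, a, b, c be four distinct points on the unit circle in ℂ. There do not exist three injective paths in the circle, from v to a, from v to b, and from v to c respectively, whose interiors are pairwise disjoint and each disjoint from {v, a, b, c}. In other words, no point of the circle can be an endpoint of three internally disjoint embedded arcs in the circle; hence no graph with a vertex of degree 3, such as K_{1,3} or K_{1,1,2}, embeds in a circle. -/
open unitInterval

/-- The interior of a path: the image of the open unit interval. -/
def pathInterior {X : Type*} [TopologicalSpace X] {x y : X} (p : Path x y) : Set X :=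
  ⇑p '' {t : I | t ≠ 0 ∧ t ≠ 1}

/-- Two points of the right half of the unit circle with equal imaginary parts are equal. -/
theorem Circle.eq_of_im_eq_of_re_pos {z w : Circle} (hz : 0 < (z : ℂ).re) (hw : 0 < (w : ℂ).re)
    (h : (z : ℂ).im = (w : ℂ).im) : z = w := by
  refine Circle.ext (Complex.ext ?_ h)
  have h₁ := Circle.normSq_coe z
  have h₂ := Circle.normSq_coe w
  rw [Complex.normSq_apply] at h₁ h₂
  rw [h] at h₁
  nlinarith

/-- An injective path in the circle starting at `v` covers, by its interior, a small one-sided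
neighbourhood of `v`, in the coordinate `z ↦ im (z / v)`. -/
theorem exists_one_sided_subset_pathInterior {v a : Circle} (p : Path v a)
    (hp : Function.Injective p) :
    ∃ s : ℝ, s ≠ 0 ∧ ∀ y ∈ Set.uIcc 0 s, y ≠ 0 →
      ∃ z ∈ pathInterior p, 0 < ((z / v : Circle) : ℂ).re ∧ ((z / v : Circle) : ℂ).im = y := by
  have hc : Continuous fun t : ℝ ↦ ((p.extend t / v : Circle) : ℂ) := by
    have := p.continuous_extend
    exact continuous_subtype_val.comp (this.div' continuous_const)
  have hre := Complex.continuous_re.comp hc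
  have him := Complex.continuous_im.comp hc
  have hopen : IsOpen {t : ℝ | 0 < ((p.extend t / v : Circle) : ℂ).re} :=
    isOpen_lt continuous_const hre
  obtain ⟨δ, hδ, hball⟩ := Metric.isOpen_iff.1 hopen 0 (by simp)
  obtain ⟨ε, hε, hεδ, hε₁⟩ : ∃ ε : ℝ, 0 < ε ∧ ε < δ ∧ ε < 1 := by
    obtain ⟨ε, hε, h⟩ := exists_between (lt_min hδ one_pos)
    exact ⟨ε, hε, lt_min_iff.1 h⟩
  have hpos : ∀ t ∈ Set.Icc 0 ε, 0 < ((p.extend t / v : Circle) : ℂ).re := fun t ht ↦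
    hball (by rw [Metric.mem_ball, Real.dist_0_eq_abs, abs_of_nonneg ht.1]; linarith [ht.2])
  refine ⟨((p.extend ε / v : Circle) : ℂ).im, fun h ↦ ?_, fun y hy hy₀ ↦ ?_⟩
  · have h₁ : p.extend ε / v = 1 :=
      Circle.eq_of_im_eq_of_re_pos (hpos ε ⟨hε.le, le_rfl⟩) (by simp) (by simpa using h)
    rw [div_eq_one, p.extend_apply ⟨hε.le, hε₁.le⟩] at h₁
    have h₂ := congrArg Subtype.val (hp (h₁.trans p.source.symm))
    exact hε.ne' h₂
  · have hivt := intermediate_value_uIcc (a := 0) (b := ε) him.continuousOn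
    obtain ⟨t, ht, rfl⟩ := hivt (by simpa using hy)
    rw [Set.uIcc_of_le hε.le] at ht
    have ht₁ : t < 1 := ht.2.trans_lt hε₁
    refine ⟨p.extend t, ?_, hpos t ht, rfl⟩
    rw [p.extend_apply ⟨ht.1, ht₁.le⟩]
    refine ⟨_, ⟨fun h ↦ hy₀ ?_, fun h ↦ ht₁.ne (congrArg Subtype.val h)⟩, rfl⟩
    have h₀ : t = 0 := congrArg Subtype.val h
    simp [h₀]

/-- Sets covering one-sided neighbourhoods of `v` on the same side intersect. -/
theorem not_disjoint_of_one_sided {v : Circle} {A B : Set Circle} {s t : ℝ} (hst : 0 < s * t)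
    (hA : ∀ y ∈ Set.uIcc 0 s, y ≠ 0 →
      ∃ z ∈ A, 0 < ((z / v : Circle) : ℂ).re ∧ ((z / v : Circle) : ℂ).im = y)
    (hB : ∀ y ∈ Set.uIcc 0 t, y ≠ 0 →
      ∃ z ∈ B, 0 < ((z / v : Circle) : ℂ).re ∧ ((z / v : Circle) : ℂ).im = y) :
    ¬ Disjoint A B := by
  obtain ⟨y, hys, hyt, hy⟩ : ∃ y, y ∈ Set.uIcc 0 s ∧ y ∈ Set.uIcc 0 t ∧ y ≠ 0 := by
    rcases pos_and_pos_or_neg_and_neg_of_mul_pos hst with ⟨hs, ht⟩ | ⟨hs, ht⟩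
    · refine ⟨min s t, ?_, ?_, (lt_min hs ht).ne'⟩ <;> simp [hs.le, ht.le]
    · refine ⟨max s t, ?_, ?_, (max_lt hs ht).ne⟩ <;> simp [hs.le, ht.le]
  obtain ⟨z, hz, hz₁, hz₂⟩ := hA y hys hy
  obtain ⟨w, hw, hw₁, hw₂⟩ := hB y hyt hy
  have hzw : z = w :=
    div_left_injective (Circle.eq_of_im_eq_of_re_pos hz₁ hw₁ (hz₂.trans hw₂.symm))
  exact Set.not_disjoint_iff.2 ⟨z, hz, hzw ▸ hw⟩

/-- No point of the circle can be an endpoint of three internally disjoint embedded arcs: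
if `v, a, b, c` are four distinct points on the unit circle, there do not exist injective paths
in the circle from `v` to `a`, from `v` to `b`, and from `v` to `c` whose interiors are pairwise
disjoint and each disjoint from `{v, a, b, c}`. -/
theorem no_degree_three_vertex_in_circle (v a b c : Circle)
    (hva : v ≠ a) (hvb : v ≠ b) (hvc : v ≠ c) (hab : a ≠ b) (hac : a ≠ c) (hbc : b ≠ c) :
    ¬ ∃ (pa : Path v a) (pb : Path v b) (pc : Path v c),
      Function.Injective ⇑pa ∧ Function.Injective ⇑pb ∧ Function.Injective ⇑pc ∧
      Disjoint (pathInterior pa) (pathInterior pb) ∧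
      Disjoint (pathInterior pa) (pathInterior pc) ∧
      Disjoint (pathInterior pb) (pathInterior pc) ∧
      Disjoint (pathInterior pa) ({v, a, b, c} : Set Circle) ∧
      Disjoint (pathInterior pb) ({v, a, b, c} : Set Circle) ∧
      Disjoint (pathInterior pc) ({v, a, b, c} : Set Circle) := by
  rintro ⟨pa, pb, pc, ha, hb, hc, dab, dac, dbc, -⟩
  obtain ⟨r, hr, hA⟩ := exists_one_sided_subset_pathInterior pa ha
  obtain ⟨s, hs, hB⟩ := exists_one_sided_subset_pathInterior pb hb
  obtain ⟨t, ht, hC⟩ := exists_one_sided_subset_pathInterior pc hc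
  have hrs : ¬ 0 < r * s := fun h ↦ not_disjoint_of_one_sided h hA hB dab
  have hrt : ¬ 0 < r * t := fun h ↦ not_disjoint_of_one_sided h hA hC dac
  have hst : ¬ 0 < s * t := fun h ↦ not_disjoint_of_one_sided h hB hC dbc
  rcases hr.lt_or_gt with hr | hr <;> rcases hs.lt_or_gt with hs | hs <;>
    rcases ht.lt_or_gt with ht | ht <;>
    simp_all [mul_pos_of_neg_of_neg]
end

section
/- Let v₁, v₂, v₃, v₄ be distinct points on the unit circle in ℂ, and let p₁, p₂, p₃, p₄ be injective paths in the circle from v₁ to v₂, from v₂ to v₃, from v₃ to v₄, and from v₄ to v₁ respectively, such that the interiors of the four paths are pairwise disjoint and each interior is disjoint from {v₁, v₂, v₃, v₄}. Then the union of the images of the four paths is the entire circle. (Any embedding of the 4-cycle K_{2,2} in a circle covers the whole circle.) -/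
open unitInterval

open Set in
/-- A point whose value under an injective real function lies strictly between the values at the
endpoints of a path belongs to the interior of the path. -/
theorem mem_pathInterior_of_lt_of_lt {X : Type*} [TopologicalSpace X] {x y z : X} (p : Path x y)
    {f : X → ℝ} (hf : Function.Injective f) (hc : Continuous (f ∘ p))
    (h : f x < f z ∧ f z < f y ∨ f y < f z ∧ f z < f x) : z ∈ pathInterior p := by
  have hz : f z ∈ range (f ∘ p) := by
    rcases h with h | h
    · exact mem_range_of_exists_le_of_exists_ge hc ⟨0, by simpa using h.1.le⟩
        ⟨1, by simpa using h.2.le⟩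
    · exact mem_range_of_exists_le_of_exists_ge hc ⟨1, by simpa using h.1.le⟩
        ⟨0, by simpa using h.2.le⟩
  obtain ⟨t, ht⟩ := hz
  have htz : p t = z := hf ht
  refine ⟨t, ⟨?_, ?_⟩, htz⟩
  · rintro rfl
    rw [p.source] at htz
    subst htz
    exact h.elim (fun h => lt_irrefl _ h.1) (fun h => lt_irrefl _ h.2)
  · rintro rfl
    rw [p.target] at htz
    subst htz
    exact h.elim (fun h => lt_irrefl _ h.2) (fun h => lt_irrefl _ h.1)

/-- The angle of a point of the circle, measured so that it jumps only at `w`. -/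
noncomputable def argCutAt (w z : Circle) : ℝ :=
  Complex.arg (-(z / w) : Circle)

theorem argCutAt_injective (w : Circle) : Function.Injective (argCutAt w) := by
  intro a b h
  simpa using Circle.injective_arg h

theorem continuousAt_argCutAt {w z : Circle} (h : z ≠ w) : ContinuousAt (argCutAt w) z := by
  have hs : ((-(z / w) : Circle) : ℂ) ∈ Complex.slitPlane := by
    rw [Complex.mem_slitPlane_iff_arg]
    refine ⟨fun hpi => h ?_, Circle.coe_ne_zero _⟩
    have hneg : -(z / w) = (-1 : Circle) :=
      Circle.injective_arg (by simpa using hpi)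
    exact div_eq_one.mp (neg_injective hneg)
  have hc : Continuous fun z : Circle => ((-(z / w) : Circle) : ℂ) := by fun_prop
  exact (Complex.continuousAt_arg hs).comp (f := fun z : Circle => ((-(z / w) : Circle) : ℂ))
    hc.continuousAt

theorem continuous_argCutAt_comp {w x y : Circle} (p : Path x y) (h : w ∉ Set.range p) :
    Continuous (argCutAt w ∘ p) :=
  continuous_iff_continuousAt.mpr fun t =>
    (continuousAt_argCutAt fun ht => h ⟨t, ht⟩).comp p.continuous.continuousAt

/-- Any embedding of the 4-cycle `K_{2,2}` in a circle covers the whole circle: if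
`v₁, v₂, v₃, v₄` are distinct points of the unit circle and `p₁, p₂, p₃, p₄` are injective paths
in the circle from `v₁` to `v₂`, `v₂` to `v₃`, `v₃` to `v₄`, and `v₄` to `v₁` whose interiors
are pairwise disjoint and disjoint from `{v₁, v₂, v₃, v₄}`, then the union of the images of the
four paths is the entire circle. -/
theorem four_cycle_covers_circle (v₁ v₂ v₃ v₄ : Circle)
    (h₁₂ : v₁ ≠ v₂) (h₁₃ : v₁ ≠ v₃) (h₁₄ : v₁ ≠ v₄)
    (h₂₃ : v₂ ≠ v₃) (h₂₄ : v₂ ≠ v₄) (h₃₄ : v₃ ≠ v₄)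
    (p₁ : Path v₁ v₂) (p₂ : Path v₂ v₃) (p₃ : Path v₃ v₄) (p₄ : Path v₄ v₁)
    (hp₁ : Function.Injective ⇑p₁) (hp₂ : Function.Injective ⇑p₂)
    (hp₃ : Function.Injective ⇑p₃) (hp₄ : Function.Injective ⇑p₄)
    (h12 : Disjoint (pathInterior p₁) (pathInterior p₂))
    (h13 : Disjoint (pathInterior p₁) (pathInterior p₃))
    (h14 : Disjoint (pathInterior p₁) (pathInterior p₄))
    (h23 : Disjoint (pathInterior p₂) (pathInterior p₃))
    (h24 : Disjoint (pathInterior p₂) (pathInterior p₄))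
    (h34 : Disjoint (pathInterior p₃) (pathInterior p₄))
    (hv₁ : Disjoint (pathInterior p₁) ({v₁, v₂, v₃, v₄} : Set Circle))
    (hv₂ : Disjoint (pathInterior p₂) ({v₁, v₂, v₃, v₄} : Set Circle))
    (hv₃ : Disjoint (pathInterior p₃) ({v₁, v₂, v₃, v₄} : Set Circle))
    (hv₄ : Disjoint (pathInterior p₄) ({v₁, v₂, v₃, v₄} : Set Circle)) :
    Set.range ⇑p₁ ∪ Set.range ⇑p₂ ∪ Set.range ⇑p₃ ∪ Set.range ⇑p₄ = Set.univ := by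
  refine Set.eq_univ_of_forall fun w => ?_
  by_contra hw
  simp only [Set.mem_union, not_or] at hw
  obtain ⟨⟨⟨hw₁, hw₂⟩, hw₃⟩, hw₄⟩ := hw
  have hf := argCutAt_injective w
  have key {x y z : Circle} {p : Path x y} (hw : w ∉ Set.range p)
      (hp : Disjoint (pathInterior p) {v₁, v₂, v₃, v₄})
      (hz : z ∈ ({v₁, v₂, v₃, v₄} : Set Circle)) :=
    fun h => Set.disjoint_left.mp hp
      (mem_pathInterior_of_lt_of_lt (z := z) p hf (continuous_argCutAt_comp p hw) h) hz
  have k₁₃ := key (z := v₃) hw₁ hv₁ (by simp)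
  have k₁₄ := key (z := v₄) hw₁ hv₁ (by simp)
  have k₂₁ := key (z := v₁) hw₂ hv₂ (by simp)
  have k₂₄ := key (z := v₄) hw₂ hv₂ (by simp)
  have k₃₁ := key (z := v₁) hw₃ hv₃ (by simp)
  have k₃₂ := key (z := v₂) hw₃ hv₃ (by simp)
  have k₄₂ := key (z := v₂) hw₄ hv₄ (by simp)
  have k₄₃ := key (z := v₃) hw₄ hv₄ (by simp)
  have n₁₂ := hf.ne h₁₂
  have n₁₃ := hf.ne h₁₃
  have n₁₄ := hf.ne h₁₄
  have n₂₃ := hf.ne h₂₃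
  have n₂₄ := hf.ne h₂₄
  have n₃₄ := hf.ne h₃₄
  clear key
  grind
end

section
/- Let γ be a complete multipartite graph with at least three nonempty partite sets. Then γ is 3-connected if and only if it is not the case that γ has exactly three partite sets of which at least two have size 1. (In particular, a complete multipartite graph with at least three partite sets that is not 3-connected must be of the form K_{n,1,1}.) -/
namespace SimpleGraph.completeMultipartiteGraph

variable {ι : Type*} {V : ι → Type*}

theorem induce_connected_of_fst_ne {T : Set (Σ i, V i)} {v w : Σ i, V i}
    (hv : v ∈ T) (hw : w ∈ T) (hvw : v.1 ≠ w.1) :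
    ((completeMultipartiteGraph V).induce T).Connected := by
  have hadj : ((completeMultipartiteGraph V).induce T).Adj ⟨w, hw⟩ ⟨v, hv⟩ := hvw.symm
  rw [connected_iff_exists_forall_reachable]
  refine ⟨⟨v, hv⟩, fun ⟨x, hx⟩ => Reachable.symm ?_⟩
  by_cases hxv : x.1 = v.1
  · have hxw : ((completeMultipartiteGraph V).induce T).Adj ⟨x, hx⟩ ⟨w, hw⟩ := by
      change x.1 ≠ w.1
      rwa [hxv]
    exact hxw.reachable.trans hadj.reachable
  · have hxv' : ((completeMultipartiteGraph V).induce T).Adj ⟨x, hx⟩ ⟨v, hv⟩ := hxv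
    exact hxv'.reachable

theorem subsingleton_of_induce_connected {T : Set (Σ i, V i)} {k : ι}
    (hT : ∀ x ∈ T, x.1 = k) (h : ((completeMultipartiteGraph V).induce T).Connected) :
    T.Subsingleton := by
  rw [← Set.subsingleton_coe]
  by_contra hns
  rw [not_subsingleton_iff_nontrivial] at hns
  obtain ⟨x⟩ := h.nonempty
  obtain ⟨y, hy⟩ := h.preconnected.exists_adj_of_nontrivial x
  have hxy : x.1.1 ≠ y.1.1 := hy
  exact hxy ((hT _ x.2).trans (hT _ y.2).symm)

/-- If deleting one partite set leaves at most two vertices, then there are exactly three partite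
sets and the two remaining ones are singletons. -/
theorem card_eq_three_of_ncard_fst_ne_le_two [Fintype ι] [∀ i, Fintype (V i)]
    [∀ i, Nonempty (V i)] (hι : 3 ≤ Fintype.card ι) {k : ι}
    (hk : {x : Σ i, V i | x.1 ≠ k}.ncard ≤ 2) :
    Fintype.card ι = 3 ∧
      ∃ i j : ι, i ≠ j ∧ Fintype.card (V i) = 1 ∧ Fintype.card (V j) = 1 := by
  classical
  let f : {x : Σ i, V i // x.1 ≠ k} → {i : ι // i ≠ k} := fun x => ⟨x.1.1, x.2⟩
  have hf : Function.Surjective f := fun ⟨i, hi⟩ =>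
    ⟨⟨⟨i, Classical.arbitrary (V i)⟩, hi⟩, rfl⟩
  have hA : Fintype.card {x : Σ i, V i // x.1 ≠ k} ≤ 2 := by
    rw [← Nat.card_eq_fintype_card]
    exact hk
  have hB : Fintype.card {i : ι // i ≠ k} = Fintype.card ι - 1 := by
    simp [Fintype.card_subtype_compl]
  have hBA := Fintype.card_le_of_surjective f hf
  have hbij : Function.Bijective f :=
    (Fintype.bijective_iff_surjective_and_card f).2 ⟨hf, by omega⟩
  have hone (i : ι) (hi : i ≠ k) : Fintype.card (V i) = 1 := by
    have : Subsingleton (V i) := ⟨fun a b => by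
      have hab := @hbij.1 ⟨⟨i, a⟩, hi⟩ ⟨⟨i, b⟩, hi⟩ rfl
      simpa using hab⟩
    exact le_antisymm (Fintype.card_le_one_iff_subsingleton.2 this) Fintype.card_pos
  obtain ⟨⟨i, hi⟩, ⟨j, hj⟩, hij⟩ :=
    Fintype.one_lt_card_iff.1 (show 1 < Fintype.card {i : ι // i ≠ k} by omega)
  exact ⟨by omega, i, j, fun h => hij (Subtype.ext h), hone i hi, hone j hj⟩

end SimpleGraph.completeMultipartiteGraph

/-- A complete multipartite graph with at least three nonempty partite sets is 3-connected
(it has at least 4 vertices and remains connected after deleting any set of at most 2 vertices)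
if and only if it is not the case that it has exactly three partite sets of which at least two
have size 1 (i.e. it is not of the form `K_{n,1,1}`). -/
theorem completeMultipartite_threeConnected_iff {ι : Type*} [Fintype ι] (V : ι → Type*)
    [∀ i, Fintype (V i)] [∀ i, Nonempty (V i)]
    (hι : 3 ≤ Fintype.card ι) :
    (4 ≤ Fintype.card (Σ i, V i) ∧
      ∀ S : Set (Σ i, V i), S.ncard ≤ 2 →
        ((SimpleGraph.completeMultipartiteGraph V).induce Sᶜ).Connected) ↔
    ¬ (Fintype.card ι = 3 ∧
        ∃ i j : ι, i ≠ j ∧ Fintype.card (V i) = 1 ∧ Fintype.card (V j) = 1) := by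
  classical
  constructor
  · rintro ⟨h4, hS⟩ ⟨h3, i, j, hij, hi, hj⟩
    obtain ⟨a, ha⟩ := Fintype.card_eq_one_iff.1 hi
    obtain ⟨b, hb⟩ := Fintype.card_eq_one_iff.1 hj
    obtain ⟨k, hk⟩ : ∃ k, ∀ l, l ≠ i → l ≠ j → l = k := by
      have hcard : (({i, j} : Finset ι)ᶜ).card = 1 := by
        rw [Finset.card_compl, Finset.card_pair hij, h3]
      obtain ⟨k, hk⟩ := Finset.card_eq_one.1 hcard
      refine ⟨k, fun l hli hlj => ?_⟩
      have hl : l ∈ ({i, j} : Finset ι)ᶜ := by simp [hli, hlj]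
      simpa [hk] using hl
    let S : Set (Σ i, V i) := {⟨i, a⟩, ⟨j, b⟩}
    have hS2 : S.ncard ≤ 2 := Set.ncard_insert_le _ _ |>.trans (by simp)
    have hfst : ∀ x ∈ Sᶜ, x.1 = k := by
      rintro ⟨l, c⟩ hx
      refine hk l ?_ ?_
      · rintro rfl
        exact hx (by simp [S, ha c])
      · rintro rfl
        exact hx (by simp [S, hb c])
    have hsub := SimpleGraph.completeMultipartiteGraph.subsingleton_of_induce_connected hfst
      (hS S hS2)
    have hle : Sᶜ.ncard ≤ 1 := Set.ncard_le_one_iff_subsingleton.2 hsub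
    have hadd := Set.ncard_add_ncard_compl S
    rw [Nat.card_eq_fintype_card] at hadd
    omega
  · intro h
    have hlt (k : ι) : 2 < {x : Σ i, V i | x.1 ≠ k}.ncard := by
      by_contra! hk
      exact h (SimpleGraph.completeMultipartiteGraph.card_eq_three_of_ncard_fst_ne_le_two hι hk)
    have : Nonempty ι := Fintype.card_pos_iff.1 (by omega)
    constructor
    · let k := Classical.arbitrary ι
      have hne : {x : Σ i, V i | x.1 ≠ k} ≠ Set.univ := fun hu =>
        (hu ▸ Set.mem_univ (⟨k, Classical.arbitrary (V k)⟩ : Σ i, V i) :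
          _ ∈ {x : Σ i, V i | x.1 ≠ k}) rfl
      have hcard := Set.ncard_lt_card hne
      rw [Nat.card_eq_fintype_card] at hcard
      have := hlt k
      omega
    · intro S hS
      have hex (k : ι) : ∃ x ∈ Sᶜ, x.1 ≠ k := by
        obtain ⟨x, hx, hxS⟩ := Set.exists_mem_notMem_of_ncard_lt_ncard (hS.trans_lt (hlt k))
        exact ⟨x, hxS, hx⟩
      obtain ⟨v, hv, -⟩ := hex (Classical.arbitrary ι)
      obtain ⟨w, hw, hwv⟩ := hex v.1
      exact SimpleGraph.completeMultipartiteGraph.induce_connected_of_fst_ne hw hv hwv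
end
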